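/- Let ρ : ℝ∖{0} → [0,∞) be a measurable even kernel with ∫_ℝ |t| ρ(t) dt = 1. Let E ⊂ ℝ be a finite disjoint union of open intervals, and let C₁, …, C_N be the connected components of ℝ∖E. Then E¹_ρ(E) = 2 Σ_{1 ≤ i,j ≤ N, i ≠ j} ∬_{C_i × C_j} ρ(s−t) ds dt + Σ_{i=1}^{N} E¹_ρ(C_i), where for an interval C, E¹_ρ(C) = 4∫∫ over the two half-lines on either side of C (equal to 0 when C is a half-line, empty, or all of ℝ). -/

import Mathlib

open MeasureTheory Metric Set Filter
open scoped ENNReal NNReal Topology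

noncomputable section

/-- Indicator of a subset of `ℝ`. -/
def ind1 (J : Set ℝ) (s : ℝ) : ℝ := J.indicator (fun _ => (1 : ℝ)) s

/-- One-dimensional nonlocal perimeter with kernel `ρ`. -/
def nlPer1 (ρ : ℝ → ℝ) (J : Set ℝ) : ℝ :=
  ∫ s : ℝ, ∫ t : ℝ, |ind1 J s - ind1 J t| * ρ (s - t)

/-- The essential boundary `∂*J` of a subset of `ℝ`: points where the density of `J`
tends neither to `0` nor to `1`. -/
def essBd1 (J : Set ℝ) : Set ℝ :=
  {x : ℝ | ¬ Tendsto (fun r : ℝ => volume (J ∩ ball x r) / volume (ball x r))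
      (𝓝[>] (0 : ℝ)) (𝓝 0) ∧
    ¬ Tendsto (fun r : ℝ => volume (J ∩ ball x r) / volume (ball x r))
      (𝓝[>] (0 : ℝ)) (𝓝 1)}

/-- One-dimensional perimeter: `P¹(J) = H⁰(∂*J)`. -/
def per1 (J : Set ℝ) : ℝ := (μH[(0 : ℝ)] (essBd1 J)).toReal

/-- One-dimensional critical energy `E¹_ρ = P¹ - Per¹_ρ`. -/
def critE1 (ρ : ℝ → ℝ) (J : Set ℝ) : ℝ := per1 J - nlPer1 ρ J

theorem aux_crossing (C : Set ℝ) {s t : ℝ} (hs : s ∈ C) (ht : t ∉ C) :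
    ∃ p ∈ frontier C, p ∈ uIcc s t := by
  by_contra hcon
  push Not at hcon
  have hpre : IsPreconnected (uIcc s t) := isPreconnected_uIcc
  have hcov : uIcc s t ⊆ interior C ∪ (closure C)ᶜ := by
    intro x hx
    by_contra hx'
    simp only [mem_union, not_or, mem_compl_iff, not_not] at hx'
    exact hcon x ⟨hx'.2, hx'.1⟩ hx
  have h1 : (uIcc s t ∩ interior C).Nonempty := by
    refine ⟨s, left_mem_uIcc, ?_⟩
    rcases hcov (left_mem_uIcc : s ∈ uIcc s t) with h | h
    · exact h
    · exact absurd (subset_closure hs) h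
  have h2 : (uIcc s t ∩ (closure C)ᶜ).Nonempty := by
    refine ⟨t, right_mem_uIcc, ?_⟩
    rcases hcov (right_mem_uIcc : t ∈ uIcc s t) with h | h
    · exact absurd (interior_subset h) ht
    · exact h
  obtain ⟨x, _, hx1, hx2⟩ := hpre _ _ isOpen_interior isClosed_closure.isOpen_compl hcov h1 h2
  exact hx2 (subset_closure (interior_subset hx1))

theorem aux_frontier_finite (C : Set ℝ) (hC : IsPreconnected C) : (frontier C).Finite := by
  have hfin : ∀ a b : ℝ, ({a, b} : Set ℝ).Finite := fun a b => by simp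
  have key : ∀ a b : ℝ, (frontier (Icc a b)).Finite ∧ (frontier (Ico a b)).Finite ∧
      (frontier (Ioc a b)).Finite ∧ (frontier (Ioo a b)).Finite := by
    intro a b
    rcases lt_trichotomy a b with h | h | h
    · rw [frontier_Icc h.le, frontier_Ico h, frontier_Ioc h, frontier_Ioo h]
      exact ⟨hfin _ _, hfin _ _, hfin _ _, hfin _ _⟩
    · subst h
      simp [frontier]
    · simp [h, h.le, Icc_eq_empty_of_lt]
  have k := key (sInf C) (sSup C)
  rcases hC.mem_intervals with h | h | h | h | h | h | h | h | h | h <;> rw [h]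
  · exact k.1
  · exact k.2.1
  · exact k.2.2.1
  · exact k.2.2.2
  · simp [frontier_Ici]
  · simp [frontier_Ioi]
  · simp [frontier_Iic]
  · simp [frontier_Iio]
  · simp
  · simp

theorem aux_volume_bound (C : Set ℝ) (F : Finset ℝ) (hF : (F : Set ℝ) = frontier C) (h : ℝ) :
    volume {s : ℝ | ind1 C s - ind1 C (s - h) ≠ 0} ≤ ENNReal.ofReal (2 * F.card * |h|) := by
  have hsub : {s : ℝ | ind1 C s - ind1 C (s - h) ≠ 0} ⊆
      ⋃ p ∈ F, Icc (p - |h|) (p + |h|) := by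
    intro s hs
    have hp : ∃ p ∈ frontier C, p ∈ uIcc s (s - h) := by
      by_cases h1 : s ∈ C <;> by_cases h2 : s - h ∈ C
      · simp [ind1, h1, h2] at hs
      · exact aux_crossing C h1 h2
      · rw [uIcc_comm]; exact aux_crossing C h2 h1
      · simp [ind1, h1, h2] at hs
    obtain ⟨p, hp, hp'⟩ := hp
    simp only [mem_iUnion]
    refine ⟨p, by rw [← Finset.mem_coe, hF]; exact hp, ?_⟩
    rw [mem_uIcc] at hp'
    have := le_abs_self h
    have := neg_abs_le h
    have := abs_nonneg h
    rw [mem_Icc]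
    rcases hp' with hp' | hp' <;> constructor <;> linarith
  refine (measure_mono hsub).trans ((measure_biUnion_finset_le _ _).trans ?_)
  simp only [Real.volume_Icc]
  have : ∀ p : ℝ, p + |h| - (p - |h|) = 2 * |h| := fun p => by ring
  simp only [this, Finset.sum_const, nsmul_eq_mul]
  rw [show 2 * (F.card : ℝ) * |h| = F.card * (2 * |h|) by ring,
    ENNReal.ofReal_mul (Nat.cast_nonneg F.card), ENNReal.ofReal_natCast]

theorem aux_measurable_ind1 {C : Set ℝ} (hC : MeasurableSet C) : Measurable (ind1 C) := by
  unfold ind1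
  exact measurable_const.indicator hC

theorem aux_integrable (ρ : ℝ → ℝ) (hmeas : Measurable ρ)
    (hint : Integrable (fun t : ℝ => |t| * ρ t)) (C : Set ℝ) (hCm : MeasurableSet C)
    (hC : (frontier C).Finite) :
    Integrable (fun z : ℝ × ℝ => |ind1 C z.1 - ind1 C z.2| * ρ (z.1 - z.2))
      (volume.prod volume) := by
  have hi := aux_measurable_ind1 hCm
  have hm : Measurable (fun z : ℝ × ℝ => |ind1 C z.1 - ind1 C z.2| * ρ (z.1 - z.2)) := by
    have h0 : Measurable (fun z : ℝ × ℝ => ind1 C z.1 - ind1 C z.2) :=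
      (hi.comp measurable_fst).sub (hi.comp measurable_snd)
    exact (continuous_abs.measurable.comp h0).mul
      (hmeas.comp (measurable_fst.sub measurable_snd))
  have hm2 : Measurable (fun z : ℝ × ℝ => |ind1 C z.1 - ind1 C (z.1 - z.2)| * ρ z.2) := by
    have h0 : Measurable (fun z : ℝ × ℝ => ind1 C z.1 - ind1 C (z.1 - z.2)) :=
      (hi.comp measurable_fst).sub (hi.comp (measurable_fst.sub measurable_snd))
    exact (continuous_abs.measurable.comp h0).mul (hmeas.comp measurable_snd)
  refine ⟨hm.aestronglyMeasurable, ?_⟩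
  unfold HasFiniteIntegral
  rw [lintegral_prod _ hm.enorm.aemeasurable]
  have e1 : ∀ s : ℝ, ∫⁻ t : ℝ, ‖|ind1 C s - ind1 C t| * ρ (s - t)‖ₑ =
      ∫⁻ h : ℝ, ‖|ind1 C s - ind1 C (s - h)| * ρ h‖ₑ := by
    intro s
    rw [← lintegral_sub_left_eq_self
      (fun h : ℝ => ‖|ind1 C s - ind1 C (s - h)| * ρ h‖ₑ) s]
    simp
  simp only [e1]
  rw [lintegral_lintegral_swap (f := fun s h : ℝ => ‖|ind1 C s - ind1 C (s - h)| * ρ h‖ₑ)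
    hm2.enorm.aemeasurable]
  set F := hC.toFinset
  have hF : (F : Set ℝ) = frontier C := hC.coe_toFinset
  have e2 : ∀ h : ℝ, ∫⁻ s : ℝ, ‖|ind1 C s - ind1 C (s - h)| * ρ h‖ₑ ≤
      ENNReal.ofReal (2 * F.card) * ‖|h| * ρ h‖ₑ := by
    intro h
    have hD : MeasurableSet {s : ℝ | ind1 C s - ind1 C (s - h) ≠ 0} := by
      have h0 : Measurable (fun s : ℝ => ind1 C s - ind1 C (s - h)) :=
        hi.sub (hi.comp (measurable_id.sub_const h))
      exact h0 (measurableSet_singleton (0 : ℝ)).compl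
    calc ∫⁻ s : ℝ, ‖|ind1 C s - ind1 C (s - h)| * ρ h‖ₑ
        ≤ ∫⁻ s : ℝ, {s : ℝ | ind1 C s - ind1 C (s - h) ≠ 0}.indicator (fun _ => ‖ρ h‖ₑ) s := by
          refine lintegral_mono fun s => ?_
          by_cases hs : ind1 C s - ind1 C (s - h) = 0
          · simp [hs]
          · rw [indicator_of_mem (by exact hs), enorm_mul]
            have : ‖|ind1 C s - ind1 C (s - h)|‖ₑ ≤ 1 := by
              rw [← ofReal_norm_eq_enorm, ENNReal.ofReal_le_one]
              by_cases h1 : s ∈ C <;> by_cases h2 : s - h ∈ C <;> simp [ind1, h1, h2]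
            calc _ ≤ 1 * ‖ρ h‖ₑ := by gcongr
              _ = _ := one_mul _
      _ = ‖ρ h‖ₑ * volume {s : ℝ | ind1 C s - ind1 C (s - h) ≠ 0} := by
          rw [lintegral_indicator hD, setLIntegral_const]
      _ ≤ ‖ρ h‖ₑ * ENNReal.ofReal (2 * F.card * |h|) := by
          gcongr
          exact aux_volume_bound C F hF h
      _ = _ := by
          rw [ENNReal.ofReal_mul (by positivity), enorm_mul]
          rw [show ‖|h|‖ₑ = ENNReal.ofReal |h| by rw [← ofReal_norm_eq_enorm]; simp]
          ring
  refine (lintegral_mono e2).trans_lt ?_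
  rw [lintegral_const_mul' _ _ ENNReal.ofReal_ne_top]
  exact ENNReal.mul_lt_top ENNReal.ofReal_lt_top hint.2

theorem aux_dens_congr {J K U : Set ℝ} {x : ℝ} (hU : U ∈ 𝓝 x) (h : J ∩ U = K ∩ U) :
    (fun r : ℝ => volume (J ∩ ball x r) / volume (ball x r)) =ᶠ[𝓝[>] (0 : ℝ)]
    (fun r : ℝ => volume (K ∩ ball x r) / volume (ball x r)) := by
  obtain ⟨ε, hε, hb⟩ := Metric.mem_nhds_iff.1 hU
  filter_upwards [Ioo_mem_nhdsGT hε] with r hr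
  have hs : ball x r ⊆ U := (ball_subset_ball hr.2.le).trans hb
  have : J ∩ ball x r = K ∩ ball x r := by
    rw [← inter_eq_self_of_subset_right hs, ← inter_assoc, ← inter_assoc, h]
  rw [this]

theorem aux_essBd_congr {J K U : Set ℝ} {x : ℝ} (hU : U ∈ 𝓝 x) (h : J ∩ U = K ∩ U) :
    x ∈ essBd1 J ↔ x ∈ essBd1 K := by
  have e := aux_dens_congr hU h
  unfold essBd1
  rw [mem_setOf_eq, mem_setOf_eq, tendsto_congr' e, tendsto_congr' e]

theorem aux_essBd_subset_closure (J : Set ℝ) : essBd1 J ⊆ closure J := by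
  intro x hx
  by_contra hxc
  have hU : (closure J)ᶜ ∈ 𝓝 x := isClosed_closure.isOpen_compl.mem_nhds hxc
  have h : J ∩ (closure J)ᶜ = ∅ ∩ (closure J)ᶜ := by
    rw [empty_inter, ← disjoint_iff_inter_eq_empty]
    exact disjoint_compl_right.mono_left subset_closure
  have := (aux_essBd_congr hU h).1 hx
  simp [essBd1] at this

theorem aux_compl_dens {J : Set ℝ} (hJ : MeasurableSet J) (x : ℝ) {a : ℝ≥0∞}
    (h : Tendsto (fun r : ℝ => volume (J ∩ ball x r) / volume (ball x r))
      (𝓝[>] (0 : ℝ)) (𝓝 a)) :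
    Tendsto (fun r : ℝ => volume (Jᶜ ∩ ball x r) / volume (ball x r))
      (𝓝[>] (0 : ℝ)) (𝓝 (1 - a)) := by
  have h1 := ENNReal.Tendsto.sub (tendsto_const_nhds (x := (1 : ℝ≥0∞))) h
    (Or.inl ENNReal.one_ne_top)
  refine h1.congr' ?_
  filter_upwards [self_mem_nhdsWithin] with r hr
  have hr0 : (0 : ℝ) < r := hr
  have hb0 : volume (ball x r) ≠ 0 := (measure_ball_pos volume x hr0).ne'
  have hbt : volume (ball x r) ≠ ∞ := measure_ball_lt_top.ne
  have hsum : volume (J ∩ ball x r) + volume (Jᶜ ∩ ball x r) = volume (ball x r) := by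
    rw [inter_comm J, inter_comm Jᶜ, ← diff_eq]
    exact measure_inter_add_diff _ hJ
  have hft : volume (J ∩ ball x r) / volume (ball x r) ≠ ∞ :=
    (ENNReal.div_lt_top ((measure_mono inter_subset_right).trans_lt hbt.lt_top).ne hb0).ne
  refine ENNReal.sub_eq_of_eq_add hft ?_
  rw [add_comm, ← ENNReal.add_div, hsum, ENNReal.div_self hb0 hbt]

theorem aux_essBd_compl {J : Set ℝ} (hJ : MeasurableSet J) : essBd1 Jᶜ = essBd1 J := by
  have key : ∀ {K : Set ℝ}, MeasurableSet K → essBd1 Kᶜ ⊆ essBd1 K := by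
    intro K hK x hx
    refine ⟨fun h => hx.2 ?_, fun h => hx.1 ?_⟩
    · simpa using aux_compl_dens hK x h
    · simpa using aux_compl_dens hK x h
  refine (key hJ).antisymm ?_
  have := key hJ.compl
  rwa [compl_compl] at this

theorem aux_essBd_frontier {J : Set ℝ} (hJ : MeasurableSet J) : essBd1 J ⊆ frontier J := by
  rw [frontier_eq_closure_inter_closure]
  refine subset_inter (aux_essBd_subset_closure J) ?_
  rw [← aux_essBd_compl hJ]
  exact aux_essBd_subset_closure _

theorem aux_haus_finite {S : Set ℝ} (hS : S.Finite) : μH[(0 : ℝ)] S < ∞ := by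
  rw [← biUnion_of_singleton S]
  exact measure_biUnion_lt_top hS fun x _ => by
    rw [Measure.hausdorffMeasure_zero_singleton]; exact ENNReal.one_lt_top

theorem aux_per {N : ℕ} (C : Fin N → Set ℝ) (E : Set ℝ) (hE : MeasurableSet E)
    (hcl : ∀ i, IsClosed (C i)) (hfr : ∀ i, (frontier (C i)).Finite)
    (hdisj : Pairwise fun i j => Disjoint (C i) (C j)) (hU : (⋃ i, C i) = Eᶜ) :
    per1 E = ∑ i, per1 (C i) := by
  have hsub : ∀ i, essBd1 (C i) ⊆ C i := fun i => by
    simpa [(hcl i).closure_eq] using aux_essBd_subset_closure (C i)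
  have hEc : IsClosed Eᶜ := by
    rw [← hU]; exact isClosed_iUnion_of_finite hcl
  have hloc : ∀ i, ∀ x ∈ C i, (x ∈ essBd1 (C i) ↔ x ∈ essBd1 Eᶜ) := by
    intro i x hx
    have hV : (⋃ j ∈ {j | j ≠ i}, C j)ᶜ ∈ 𝓝 x := by
      refine (((Set.toFinite {j | j ≠ i}).isClosed_biUnion
        fun j _ => hcl j).isOpen_compl).mem_nhds ?_
      simp only [mem_compl_iff, mem_iUnion, not_exists]
      intro j hj hxj
      exact (Set.disjoint_left.1 (hdisj hj)) hxj hx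
    refine aux_essBd_congr hV ?_
    rw [← hU]
    ext y
    simp only [mem_inter_iff, mem_compl_iff, mem_iUnion, not_exists, mem_setOf_eq]
    constructor
    · rintro ⟨h1, h2⟩
      exact ⟨⟨i, h1⟩, h2⟩
    · rintro ⟨⟨j, hj⟩, h2⟩
      refine ⟨?_, h2⟩
      by_cases hji : j = i
      · exact hji ▸ hj
      · exact absurd hj (h2 j hji)
  have heq : essBd1 E = ⋃ i, essBd1 (C i) := by
    rw [← aux_essBd_compl hE]
    ext x
    rw [mem_iUnion]
    constructor
    · intro hx
      have hx' : x ∈ Eᶜ := by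
        simpa only [hEc.closure_eq] using aux_essBd_subset_closure _ hx
      rw [← hU, mem_iUnion] at hx'
      obtain ⟨i, hi⟩ := hx'
      exact ⟨i, (hloc i x hi).2 hx⟩
    · rintro ⟨i, hi⟩
      exact (hloc i x (hsub i hi)).1 hi
  have hfin : ∀ i, (essBd1 (C i)).Finite := fun i =>
    (hfr i).subset (aux_essBd_frontier (hcl i).measurableSet)
  unfold per1
  rw [heq, measure_iUnion (fun i j hij => (hdisj hij).mono (hsub i) (hsub j))
    (fun i => (hfin i).measurableSet), tsum_fintype,
    ENNReal.toReal_sum fun i _ => (aux_haus_finite (hfin i)).ne]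

theorem aux_pointwise {N : ℕ} (C : Fin N → Set ℝ) (E : Set ℝ)
    (hdisj : Pairwise fun i j => Disjoint (C i) (C j)) (hU : (⋃ i, C i) = Eᶜ) (s t : ℝ) :
    |ind1 E s - ind1 E t| = ∑ i, |ind1 (C i) s - ind1 (C i) t| -
      2 * ∑ i, ∑ j, if i = j then 0 else ind1 (C i) s * ind1 (C j) t := by
  classical
  have hone : ∀ x i, x ∈ C i → ∀ j, ind1 (C j) x = if j = i then 1 else 0 := by
    intro x i hx j
    by_cases hji : j = i
    · subst hji; simp [ind1, hx]
    · have : x ∉ C j := fun h => Set.disjoint_left.1 (hdisj hji) h hx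
      simp [ind1, hji, this]
  have hE : ∀ x i, x ∈ C i → ind1 E x = 0 := by
    intro x i hx
    have : x ∈ Eᶜ := hU ▸ mem_iUnion.2 ⟨i, hx⟩
    simp [ind1, show x ∉ E from this]
  have hzero : ∀ x, (∀ i, x ∉ C i) → (∀ j, ind1 (C j) x = 0) ∧ ind1 E x = 1 := by
    intro x hx
    refine ⟨fun j => by simp [ind1, hx j], ?_⟩
    have : x ∈ E := by
      by_contra h
      have h' : x ∈ ⋃ i, C i := hU ▸ h
      obtain ⟨i, hi⟩ := mem_iUnion.1 h'
      exact hx i hi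
    simp [ind1, this]
  by_cases h1 : ∃ i, s ∈ C i <;> by_cases h2 : ∃ j, t ∈ C j
  · obtain ⟨a, ha⟩ := h1
    obtain ⟨b, hb⟩ := h2
    simp only [hone s a ha, hone t b hb, hE s a ha, hE t b hb]
    by_cases hab : a = b
    · subst hab
      have : ∀ i j : Fin N, (if i = j then (0 : ℝ) else
          (if i = a then 1 else 0) * (if j = a then 1 else 0)) = 0 := by
        intro i j
        split_ifs <;> simp_all
      simp only [this]
      simp
    · have e1 : ∀ i : Fin N, |(if i = a then (1 : ℝ) else 0) - (if i = b then 1 else 0)| =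
          (if i = a then 1 else 0) + (if i = b then 1 else 0) := by
        intro i
        split_ifs <;> simp_all
      have e2 : ∀ i j : Fin N, (if i = j then (0 : ℝ) else
          (if i = a then 1 else 0) * (if j = b then 1 else 0)) =
          (if i = a then 1 else 0) * (if j = b then 1 else 0) := by
        intro i j
        split_ifs <;> simp_all
      simp only [e1, e2, Finset.sum_add_distrib, ← Finset.mul_sum, Finset.sum_ite_eq',
        Finset.mem_univ, if_true]
      norm_num
  · obtain ⟨a, ha⟩ := h1
    push Not at h2
    obtain ⟨h3, h4⟩ := hzero t h2
    simp [hone s a ha, hE s a ha, h3, h4, apply_ite abs]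
  · obtain ⟨b, hb⟩ := h2
    push Not at h1
    obtain ⟨h3, h4⟩ := hzero s h1
    simp [hone t b hb, hE t b hb, h3, h4, apply_ite abs]
  · push Not at h1 h2
    obtain ⟨h3, h4⟩ := hzero s h1
    obtain ⟨h5, h6⟩ := hzero t h2
    simp [h3, h4, h5, h6]

theorem aux_nlPer (ρ : ℝ → ℝ) (hmeas : Measurable ρ)
    (hint : Integrable (fun t : ℝ => |t| * ρ t)) {N : ℕ} (C : Fin N → Set ℝ) (E : Set ℝ)
    (hE : MeasurableSet E)
    (hcl : ∀ i, IsClosed (C i)) (hfr : ∀ i, (frontier (C i)).Finite)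
    (hdisj : Pairwise fun i j => Disjoint (C i) (C j)) (hU : (⋃ i, C i) = Eᶜ) :
    nlPer1 ρ E = ∑ i, nlPer1 ρ (C i) - 2 * (∑ i : Fin N, ∑ j : Fin N,
        if i = j then 0 else ∫ s in C i, (∫ t in C j, ρ (s - t))) := by
  have hI : ∀ i, Integrable (fun z : ℝ × ℝ =>
      |ind1 (C i) z.1 - ind1 (C i) z.2| * ρ (z.1 - z.2)) (volume.prod volume) := fun i =>
    aux_integrable ρ hmeas hint (C i) (hcl i).measurableSet (hfr i)
  have hK : ∀ i j, i ≠ j → Integrable (fun z : ℝ × ℝ =>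
      (ind1 (C i) z.1 * ind1 (C j) z.2) * ρ (z.1 - z.2)) (volume.prod volume) := by
    intro i j hij
    refine (hI i).mono ?_ (Eventually.of_forall fun z => ?_)
    · exact ((((aux_measurable_ind1 (hcl i).measurableSet).comp measurable_fst).mul
        ((aux_measurable_ind1 (hcl j).measurableSet).comp measurable_snd)).mul
        (hmeas.comp (measurable_fst.sub measurable_snd))).aestronglyMeasurable
    · rw [norm_mul _ (ρ _), norm_mul _ (ρ _)]
      gcongr
      by_cases h1 : z.1 ∈ C i <;> by_cases h2 : z.2 ∈ C j
      · have : z.2 ∉ C i := fun h => Set.disjoint_left.1 (hdisj hij) h h2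
        simp [ind1, h1, h2, this]
      all_goals simp [ind1, h1, h2]
  have hP : ∀ i, nlPer1 ρ (C i) = ∫ z : ℝ × ℝ,
      |ind1 (C i) z.1 - ind1 (C i) z.2| * ρ (z.1 - z.2) ∂(volume.prod volume) := fun i =>
    (integral_prod _ (hI i)).symm
  have hQ : ∀ i j, (if i = j then 0 else ∫ s in C i, (∫ t in C j, ρ (s - t))) =
      ∫ z : ℝ × ℝ, (if i = j then 0 else ind1 (C i) z.1 * ind1 (C j) z.2) * ρ (z.1 - z.2)
        ∂(volume.prod volume) := by
    intro i j
    by_cases hij : i = j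
    · simp [hij]
    · simp only [hij, if_false]
      rw [integral_prod _ (hK i j hij), ← integral_indicator (hcl i).measurableSet]
      congr 1
      ext s
      by_cases hs : s ∈ C i
      · rw [indicator_of_mem hs, ← integral_indicator (hcl j).measurableSet]
        congr 1
        ext t
        by_cases ht : t ∈ C j <;> simp [ind1, hs, ht]
      · simp [ind1, hs]
  have hK' : ∀ i j, Integrable (fun z : ℝ × ℝ =>
      (if i = j then 0 else ind1 (C i) z.1 * ind1 (C j) z.2) * ρ (z.1 - z.2))
      (volume.prod volume) := by
    intro i j
    by_cases hij : i = j
    · simp [hij]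
    · simpa [hij] using hK i j hij
  have hpt : (fun z : ℝ × ℝ => |ind1 E z.1 - ind1 E z.2| * ρ (z.1 - z.2)) =
      fun z => (∑ i, |ind1 (C i) z.1 - ind1 (C i) z.2| * ρ (z.1 - z.2)) -
      2 * ∑ i, ∑ j, (if i = j then 0 else ind1 (C i) z.1 * ind1 (C j) z.2) * ρ (z.1 - z.2) := by
    ext z
    rw [aux_pointwise C E hdisj hU z.1 z.2, sub_mul, Finset.sum_mul, mul_assoc, Finset.sum_mul]
    simp only [Finset.sum_mul]
  have i1 : Integrable (fun z : ℝ × ℝ =>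
      ∑ i, |ind1 (C i) z.1 - ind1 (C i) z.2| * ρ (z.1 - z.2)) (volume.prod volume) :=
    integrable_finset_sum _ fun i _ => hI i
  have i2 : ∀ i, Integrable (fun z : ℝ × ℝ =>
      ∑ j, (if i = j then 0 else ind1 (C i) z.1 * ind1 (C j) z.2) * ρ (z.1 - z.2))
      (volume.prod volume) := fun i => integrable_finset_sum _ fun j _ => hK' i j
  have i3 : Integrable (fun z : ℝ × ℝ =>
      2 * ∑ i, ∑ j, (if i = j then 0 else ind1 (C i) z.1 * ind1 (C j) z.2) * ρ (z.1 - z.2))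
      (volume.prod volume) := (integrable_finset_sum _ fun i _ => i2 i).const_mul 2
  have hIE : Integrable (fun z : ℝ × ℝ => |ind1 E z.1 - ind1 E z.2| * ρ (z.1 - z.2))
      (volume.prod volume) := by
    rw [hpt]; exact i1.sub i3
  have hPE : nlPer1 ρ E = ∫ z : ℝ × ℝ,
      |ind1 E z.1 - ind1 E z.2| * ρ (z.1 - z.2) ∂(volume.prod volume) :=
    (integral_prod _ hIE).symm
  rw [hPE, hpt, integral_sub i1 i3, integral_finset_sum _ fun i _ => hI i,
    integral_const_mul, integral_finset_sum _ fun i _ => i2 i]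
  simp only [hP, hQ]
  congr 2
  refine Finset.sum_congr rfl fun i _ => ?_
  rw [integral_finset_sum _ fun j _ => hK' i j]

theorem aux_component_closed {F : Set ℝ} (hF : IsClosed F) {x : ℝ} (hx : x ∈ F) :
    IsClosed (connectedComponentIn F x) := by
  rw [← closure_subset_iff_isClosed]
  refine IsPreconnected.subset_connectedComponentIn isPreconnected_connectedComponentIn.closure
    (subset_closure (mem_connectedComponentIn hx)) ?_
  exact hF.closure_subset_iff.2 (connectedComponentIn_subset F x)

/-- For a measurable even nonnegative kernel `ρ` on `ℝ ∖ {0}` with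
`∫ |t| ρ(t) dt = 1`, if `E` is a finite disjoint union of open intervals and
`C₁, …, C_N` are the connected components of `ℝ ∖ E`, then
`E¹_ρ(E) = 2 Σ_{i ≠ j} ∬_{C_i × C_j} ρ(s - t) + Σ_i E¹_ρ(C_i)`. -/
theorem critE1_decomposition (ρ : ℝ → ℝ)
    (hmeas : Measurable ρ) (hnn : ∀ t : ℝ, t ≠ 0 → 0 ≤ ρ t)
    (heven : ∀ t : ℝ, ρ (-t) = ρ t)
    (hnorm : (∫ t : ℝ, |t| * ρ t) = 1)
    (hint : Integrable (fun t : ℝ => |t| * ρ t))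
    (E : Set ℝ)
    (hE : ∃ (k : ℕ) (I : Fin k → Set ℝ),
      (∀ i, IsOpen (I i)) ∧ (∀ i, (I i).Nonempty) ∧ (∀ i, IsPreconnected (I i)) ∧
      (Pairwise fun i j => Disjoint (I i) (I j)) ∧ E = ⋃ i, I i)
    (N : ℕ) (C : Fin N → Set ℝ)
    (hC : (∀ i, ∃ x ∈ Eᶜ, C i = connectedComponentIn Eᶜ x) ∧
      (⋃ i, C i) = Eᶜ ∧ Function.Injective C) :
    critE1 ρ E =
      2 * (∑ i : Fin N, ∑ j : Fin N,
        if i = j then 0 else ∫ s in C i, (∫ t in C j, ρ (s - t))) +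
      ∑ i : Fin N, critE1 ρ (C i) := by
  obtain ⟨hC1, hU, hinj⟩ := hC
  obtain ⟨k, I, hIo, -, -, -, hEI⟩ := hE
  have hEo : IsOpen E := hEI ▸ isOpen_iUnion hIo
  have hcl : ∀ i, IsClosed (C i) := by
    intro i
    obtain ⟨x, hx, hi⟩ := hC1 i
    rw [hi]
    exact aux_component_closed hEo.isClosed_compl hx
  have hfr : ∀ i, (frontier (C i)).Finite := by
    intro i
    obtain ⟨x, hx, hi⟩ := hC1 i
    rw [hi]
    exact aux_frontier_finite _ isPreconnected_connectedComponentIn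
  have hdisj : Pairwise fun i j => Disjoint (C i) (C j) := by
    intro i j hij
    rw [Set.disjoint_left]
    intro y hyi hyj
    apply hij
    apply hinj
    obtain ⟨x, hx, hi⟩ := hC1 i
    obtain ⟨x', hx', hj⟩ := hC1 j
    rw [hi] at hyi
    rw [hj] at hyj
    rw [hi, hj, connectedComponentIn_eq hyi, connectedComponentIn_eq hyj]
  have h1 := aux_per C E hEo.measurableSet hcl hfr hdisj hU
  have h2 := aux_nlPer ρ hmeas hint C E hEo.measurableSet hcl hfr hdisj hU
  simp only [critE1, Finset.sum_sub_distrib]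
  rw [h1, h2]
  ring
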